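/- Let n ≥ 2 be an integer and s > n/2 a real number with 2s ∈ ℤ, and work on (0, π/2]. Let q ≥ 0 be an even integer, set ν = s + q and m = q/2 + 1. Let E⁰ be the set of tuples (b₀, …, b_m) ∈ (A⁰)^{m+1} such that I_{s,ν}(b_m) = 0, and define J(b₀, …, b_m) = (c₀, …, c_{m−1}) where c_i(θ) = (I_{s,ν} b_i)(θ) + (i + 1)(ν − i)·sin²(θ)·b_{i+1}(θ) + (i + 2)(i + 1)·sin²(θ)·b_{i+2}(θ), with b_j := 0 for j > m. Then: (i) J maps E⁰ into B^m; (ii) J : E⁰ → B^m is surjective; and (iii) there exists a nonzero β ∈ A⁰ with I_{s,ν} β = 0, and the kernel of J on E⁰ equals {(t·β, 0, …, 0) : t ∈ ℝ}; in particular the kernel is one-dimensional. -/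

import Mathlib

open Real Set Filter

/-- One-sided derivative on `(0, π/2]`. -/
noncomputable def dW (u : ℝ → ℝ) : ℝ → ℝ := derivWithin u (Set.Ioc 0 (Real.pi / 2))

/-- The indicial operator `I_{s,ν}` on `(0, π/2]`, with derivatives taken within
`(0, π/2]`. -/
noncomputable def IopW (n : ℕ) (s ν : ℝ) (u : ℝ → ℝ) (θ : ℝ) : ℝ :=
  Real.sin θ ^ 2 * dW (dW u) θ
    + (1 - (n : ℝ)) * Real.sin θ * Real.cos θ * dW u θ
    + ν * (ν + 1 - (n : ℝ)) * Real.sin θ ^ 2 * u θ + s * ((n : ℝ) - s) * u θ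

/-- Membership in `A⁰`: `u(θ) = θ^{n-s} g₀(θ) + θ^s log(θ) g₁(θ)` with `g₀, g₁`
smooth up to the boundary, `θ^{s-n} u(θ) → 0` as `θ → 0⁺`, and `u'(π/2) = 0`. -/
def memA0 (n : ℕ) (s : ℝ) (u : ℝ → ℝ) : Prop :=
  (∃ g₀ g₁ : ℝ → ℝ, ContDiff ℝ (⊤ : ℕ∞) g₀ ∧ ContDiff ℝ (⊤ : ℕ∞) g₁ ∧
    ∀ θ ∈ Set.Ioc 0 (Real.pi / 2),
      u θ = θ ^ ((n : ℝ) - s) * g₀ θ + θ ^ s * Real.log θ * g₁ θ) ∧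
  Filter.Tendsto (fun θ => θ ^ (s - (n : ℝ)) * u θ)
    (nhdsWithin 0 (Set.Ioi 0)) (nhds 0) ∧
  dW u (Real.pi / 2) = 0

/-- Membership in `B`: `f(θ) = θ^{n-s+1} g₀(θ) + θ^{s+1} log(θ) g₁(θ)` with
`g₀, g₁` smooth up to the boundary. -/
def memB (n : ℕ) (s : ℝ) (f : ℝ → ℝ) : Prop :=
  ∃ g₀ g₁ : ℝ → ℝ, ContDiff ℝ (⊤ : ℕ∞) g₀ ∧ ContDiff ℝ (⊤ : ℕ∞) g₁ ∧
    ∀ θ ∈ Set.Ioc 0 (Real.pi / 2),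
      f θ = θ ^ ((n : ℝ) - s + 1) * g₀ θ + θ ^ (s + 1) * Real.log θ * g₁ θ

/-- The map `J` on tuples of coefficient functions:
`(J b)_i = I_{s,ν} b_i + (i+1)(ν-i) sin²θ · b_{i+1} + (i+2)(i+1) sin²θ · b_{i+2}`. -/
noncomputable def Jmap (n : ℕ) (s ν : ℝ) (b : ℕ → ℝ → ℝ) (i : ℕ) (θ : ℝ) : ℝ :=
  IopW n s ν (b i) θ
    + ((i : ℝ) + 1) * (ν - (i : ℝ)) * Real.sin θ ^ 2 * b (i + 1) θ
    + ((i : ℝ) + 2) * ((i : ℝ) + 1) * Real.sin θ ^ 2 * b (i + 2) θ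

/-- Membership in `E⁰`: tuples `(b₀, …, b_m)` of elements of `A⁰` (extended by
zero) whose top coefficient `b_m` lies in the kernel of `I_{s,ν}` on `(0, π/2]`. -/
def memE0 (n : ℕ) (s ν : ℝ) (m : ℕ) (b : ℕ → ℝ → ℝ) : Prop :=
  (∀ i ≤ m, memA0 n s (b i)) ∧ (∀ j, m < j → b j = fun _ => 0) ∧
  (∀ θ ∈ Set.Ioc 0 (Real.pi / 2), IopW n s ν (b m) θ = 0)

section SmoothDivision

open scoped ContDiff Topology

lemma hasDerivAt_integral_pow_mul_comp (r : ℕ) {g : ℝ → ℝ} (hg : ContDiff ℝ ∞ g) (x : ℝ) :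
    HasDerivAt (fun x => ∫ t in (0 : ℝ)..1, t ^ r * g (t * x))
      (∫ t in (0 : ℝ)..1, t ^ (r + 1) * deriv g (t * x)) x := by
  have hg' : Continuous (deriv g) := (contDiff_infty_iff_deriv.1 hg).2.continuous
  have hgd : Differentiable ℝ g := (contDiff_infty_iff_deriv.1 hg).1
  have hgc : Continuous g := hg.continuous
  obtain ⟨C, hC⟩ := (isCompact_Icc (a := -(|x| + 1)) (b := |x| + 1)).exists_bound_of_continuousOn
    hg'.continuousOn
  refine (intervalIntegral.hasDerivAt_integral_of_dominated_loc_of_deriv_le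
    (F := fun x t => t ^ r * g (t * x)) (F' := fun x t => t ^ (r + 1) * deriv g (t * x))
    (bound := fun _ => C) (Metric.ball_mem_nhds x one_pos) ?_ ?_ ?_ ?_ ?_ ?_).2
  · exact Eventually.of_forall fun y => (by fun_prop : Continuous _).aestronglyMeasurable
  · exact (by fun_prop : Continuous _).intervalIntegrable _ _
  · exact (by fun_prop : Continuous _).aestronglyMeasurable
  · refine Eventually.of_forall fun t ht y hy => ?_
    rw [uIoc_of_le zero_le_one] at ht
    have hy' : |y| ≤ |x| + 1 := by
      have h1 : |y - x| < 1 := by simpa [Real.dist_eq] using hy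
      have h2 := abs_sub_abs_le_abs_sub y x
      linarith
    have hty : |t * y| ≤ |x| + 1 := by
      rw [abs_mul, abs_of_pos ht.1]
      nlinarith [ht.2, ht.1, abs_nonneg y]
    have h3 := hC (t * y) (abs_le.1 hty)
    rw [norm_mul, norm_pow, Real.norm_eq_abs, abs_of_pos ht.1]
    calc t ^ (r + 1) * ‖deriv g (t * y)‖ ≤ 1 * ‖deriv g (t * y)‖ := by
          gcongr
          exact pow_le_one₀ ht.1.le ht.2
      _ ≤ C := by rw [one_mul]; exact h3
  · exact intervalIntegrable_const
  · refine Eventually.of_forall fun t _ y _ => ?_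
    have h1 : HasDerivAt (fun y => t * y) t y := by
      simpa using (hasDerivAt_id y).const_mul t
    have h2 := ((hgd (t * y)).hasDerivAt.comp y h1).const_mul (t ^ r)
    exact h2.congr_deriv (by ring)

lemma contDiff_integral_pow_mul_comp (r : ℕ) {g : ℝ → ℝ} (hg : ContDiff ℝ ∞ g) :
    ContDiff ℝ ∞ (fun x => ∫ t in (0 : ℝ)..1, t ^ r * g (t * x)) := by
  refine contDiff_infty.2 fun N => ?_
  induction N generalizing r g with
  | zero =>
    exact contDiff_zero.2 (continuous_iff_continuousAt.2 fun x =>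
      (hasDerivAt_integral_pow_mul_comp r hg x).continuousAt)
  | succ N ih =>
    have h := hasDerivAt_integral_pow_mul_comp r hg
    push_cast
    rw [contDiff_succ_iff_deriv]
    refine ⟨fun x => (h x).differentiableAt, by simp, ?_⟩
    rw [show deriv (fun x => ∫ t in (0 : ℝ)..1, t ^ r * g (t * x)) = _ from
      funext fun x => (h x).deriv]
    exact ih (r + 1) (contDiff_infty_iff_deriv.1 hg).2

/-- The Euler equation `(r + 1) K + x K' = g` has a smooth solution. -/
lemma exists_euler_solution (r : ℕ) {g : ℝ → ℝ} (hg : ContDiff ℝ ∞ g) :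
    ∃ K : ℝ → ℝ, ContDiff ℝ ∞ K ∧ ∀ x, (r + 1) * K x + x * deriv K x = g x := by
  refine ⟨_, contDiff_integral_pow_mul_comp r hg, fun x => ?_⟩
  have hg' : Continuous (deriv g) := (contDiff_infty_iff_deriv.1 hg).2.continuous
  have hgd : Differentiable ℝ g := (contDiff_infty_iff_deriv.1 hg).1
  have hgc : Continuous g := hg.continuous
  rw [(hasDerivAt_integral_pow_mul_comp r hg x).deriv, ← intervalIntegral.integral_const_mul,
    ← intervalIntegral.integral_const_mul, ← intervalIntegral.integral_add]
  · have h : ∀ t ∈ uIcc (0 : ℝ) 1, HasDerivAt (fun t => t ^ (r + 1) * g (t * x))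
        (((r : ℝ) + 1) * (t ^ r * g (t * x)) + x * (t ^ (r + 1) * deriv g (t * x))) t := by
      intro t _
      have h1 : HasDerivAt (fun t => t * x) x t := by
        simpa using (hasDerivAt_id t).mul_const x
      have h2 := (hasDerivAt_pow (r + 1) t).mul ((hgd (t * x)).hasDerivAt.comp t h1)
      refine h2.congr_deriv ?_
      simp only [Function.comp_apply]
      push_cast
      ring
    rw [intervalIntegral.integral_eq_sub_of_hasDerivAt h
      ((by fun_prop : Continuous _).intervalIntegrable _ _)]
    simp
  · exact (by fun_prop : Continuous _).intervalIntegrable _ _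
  · exact (by fun_prop : Continuous _).intervalIntegrable _ _

/-- Hadamard's lemma in one variable. -/
lemma exists_smooth_eq_add_mul {g : ℝ → ℝ} (hg : ContDiff ℝ ∞ g) :
    ∃ K : ℝ → ℝ, ContDiff ℝ ∞ K ∧ ∀ x, g x = g 0 + x * K x := by
  have hgd := contDiff_infty_iff_deriv.1 hg
  obtain ⟨K, hK, h⟩ := exists_euler_solution 0 hgd.2
  have hKd : Differentiable ℝ K := (contDiff_infty_iff_deriv.1 hK).1
  refine ⟨K, hK, fun x => ?_⟩
  have hder : ∀ y, HasDerivAt (fun y => g y - y * K y) 0 y := fun y => by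
    have h1 := (hgd.1 y).hasDerivAt.sub ((hasDerivAt_id y).mul (hKd y).hasDerivAt)
    refine h1.congr_deriv ?_
    have h2 := h y
    push_cast at h2
    simp only [id]
    linarith
  have h3 := is_const_of_deriv_eq_zero (fun y => (hder y).differentiableAt)
    (fun y => (hder y).deriv) x 0
  simp only [zero_mul, sub_zero] at h3
  linarith

/-- A positive smooth function which equals `sin x / x` on `[0, π/2]`. -/
lemma exists_smooth_sin_eq_mul : ∃ S : ℝ → ℝ, ContDiff ℝ ∞ S ∧ (∀ x, 0 < S x) ∧ S 0 = 1 ∧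
    ∀ x ∈ Set.Icc 0 (Real.pi / 2), Real.sin x = x * S x := by
  obtain ⟨K, hK, h⟩ := exists_smooth_eq_add_mul (g := Real.sin) Real.contDiff_sin
  simp only [Real.sin_zero, zero_add] at h
  have hK0 : K 0 = 1 := by
    have h1 : HasDerivAt Real.sin (1 * K 0 + 0 * deriv K 0) 0 := by
      rw [show Real.sin = fun x => x * K x from funext h]
      exact (hasDerivAt_id (0 : ℝ)).mul ((contDiff_infty_iff_deriv.1 hK).1 0).hasDerivAt
    have h2 := h1.unique (Real.hasDerivAt_sin 0)
    simpa using h2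
  have hpi := Real.pi_pos
  have hpos : ∀ x, |x| < Real.pi → 0 < K x := by
    intro x hx
    rw [abs_lt] at hx
    rcases lt_trichotomy x 0 with h0 | h0 | h0
    · have := Real.sin_neg_of_neg_of_neg_pi_lt h0 hx.1
      rw [h x] at this
      exact pos_of_mul_neg_right this h0.le
    · rw [h0, hK0]; exact one_pos
    · have := Real.sin_pos_of_pos_of_lt_pi h0 hx.2
      rw [h x] at this
      exact pos_of_mul_pos_right this h0.le
  let χ : ContDiffBump (0 : ℝ) := ⟨Real.pi / 2, Real.pi, by positivity, by linarith⟩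
  have hχ : ∀ x ∈ Set.Icc 0 (Real.pi / 2), χ x = 1 := by
    intro x hx
    refine χ.one_of_mem_closedBall ?_
    rw [Metric.mem_closedBall, Real.dist_eq, sub_zero, abs_of_nonneg hx.1]
    exact hx.2
  refine ⟨fun x => χ x * K x + (1 - χ x), ?_, ?_, ?_, ?_⟩
  · exact (χ.contDiff.mul hK).add (contDiff_const.sub χ.contDiff)
  · intro x
    rcases lt_or_ge |x| Real.pi with hx | hx
    · have h1 := hpos x hx
      have h2 : 0 ≤ χ x := χ.nonneg
      have h3 : χ x ≤ 1 := χ.le_one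
      rcases h2.eq_or_lt with h4 | h4
      · simp [← h4]
      · have := mul_pos h4 h1
        dsimp only; linarith
    · have : χ x = 0 := χ.zero_of_le_dist (by rw [Real.dist_eq, sub_zero]; exact hx)
      simp [this]
  · simp [hχ 0 ⟨le_rfl, by positivity⟩, hK0]
  · intro x hx
    simp [hχ x hx, h x]

end SmoothDivision

section Antiderivatives

open scoped ContDiff

lemma exists_antideriv_add_pow_mul_log (k : ℕ) {g₀ g₁ : ℝ → ℝ} (hg₀ : ContDiff ℝ ∞ g₀)
    (hg₁ : ContDiff ℝ ∞ g₁) :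
    ∃ h₀ h₁ : ℝ → ℝ, ContDiff ℝ ∞ h₀ ∧ ContDiff ℝ ∞ h₁ ∧ ∀ x, 0 < x →
      HasDerivAt (fun x => x * h₀ x + x ^ (k + 1) * Real.log x * h₁ x)
        (g₀ x + x ^ k * Real.log x * g₁ x) x := by
  obtain ⟨K, hK, hK'⟩ := exists_euler_solution k hg₁
  obtain ⟨M, hM, hM'⟩ := exists_euler_solution 0
    (hg₀.sub ((contDiff_id.pow k).mul hK) : ContDiff ℝ ∞ fun x => g₀ x - x ^ k * K x)
  refine ⟨M, K, hM, hK, fun x hx => ?_⟩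
  have hKd := ((contDiff_infty_iff_deriv.1 hK).1 x).hasDerivAt
  have hMd := ((contDiff_infty_iff_deriv.1 hM).1 x).hasDerivAt
  refine (((hasDerivAt_id x).mul hMd).add
    (((hasDerivAt_pow (k + 1) x).mul (Real.hasDerivAt_log hx.ne')).mul hKd)).congr_deriv ?_
  have h1 := hK' x
  have h2 := hM' x
  have h3 : x ^ (k + 1) * x⁻¹ = x ^ k := by
    rw [pow_succ, mul_assoc, mul_inv_cancel₀ hx.ne', mul_one]
  simp only [id, Nat.add_sub_cancel, Pi.mul_apply]
  push_cast at h2 ⊢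
  rw [h3]
  linear_combination h2 + x ^ k * Real.log x * h1

lemma exists_antideriv_rpow_neg_mul (k : ℕ) {g : ℝ → ℝ} (hg : ContDiff ℝ ∞ g) :
    ∃ (c : ℝ) (h : ℝ → ℝ), ContDiff ℝ ∞ h ∧ ∀ x, 0 < x →
      HasDerivAt (fun x => x ^ (1 - (k : ℝ)) * h x + c * Real.log x) (x ^ (-(k : ℝ)) * g x) x := by
  induction k generalizing g with
  | zero =>
    obtain ⟨M, hM, hM'⟩ := exists_euler_solution 0 hg
    refine ⟨0, M, hM, fun x hx => ?_⟩
    have hMd := ((contDiff_infty_iff_deriv.1 hM).1 x).hasDerivAt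
    simp only [Nat.cast_zero, sub_zero, Real.rpow_one, zero_mul, add_zero, neg_zero,
      Real.rpow_zero]
    refine ((hasDerivAt_id x).mul hMd).congr_deriv ?_
    have h2 := hM' x
    simp only [id]
    push_cast at h2
    linear_combination h2
  | succ k ih =>
    obtain ⟨K, hK, hK'⟩ := exists_smooth_eq_add_mul hg
    obtain ⟨c, h, hh, hd⟩ := ih hK
    have hsplit : ∀ x : ℝ, 0 < x → x ^ (-((k + 1 : ℕ) : ℝ)) * g x
        = x ^ (-((k + 1 : ℕ) : ℝ)) * g 0 + x ^ (-(k : ℝ)) * K x := by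
      intro x hx
      have : x ^ (-(k : ℝ)) = x ^ (-((k + 1 : ℕ) : ℝ)) * x := by
        rw [← Real.rpow_add_one hx.ne']; congr 1; push_cast; ring
      rw [this, hK' x]; ring
    rcases Nat.eq_zero_or_pos k with rfl | hk
    · refine ⟨g 0 + c, fun x => x * h x, contDiff_id.mul hh, fun x hx => ?_⟩
      rw [hsplit x hx]
      have h1 := ((Real.hasDerivAt_log hx.ne').const_mul (g 0)).add (hd x hx)
      refine (h1.congr_deriv ?_).congr_of_eventuallyEq ?_
      · simp [Real.rpow_neg_one]; ring
      · refine Eventually.of_forall fun y => ?_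
        simp
        ring
    · have hk0 : (k : ℝ) ≠ 0 := by exact_mod_cast hk.ne'
      refine ⟨c, fun x => -(g 0 / k) + x * h x, contDiff_const.add (contDiff_id.mul hh),
        fun x hx => ?_⟩
      rw [hsplit x hx]
      have h1 := ((Real.hasDerivAt_rpow_const (x := x) (p := -(k : ℝ))
        (Or.inl hx.ne')).const_mul (-(g 0 / k))).add (hd x hx)
      refine (h1.congr_deriv ?_).congr_of_eventuallyEq ?_
      · have : -(k : ℝ) - 1 = -((k + 1 : ℕ) : ℝ) := by push_cast; ring
        rw [this]
        field_simp
      · filter_upwards [lt_mem_nhds hx] with y hy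
        have e1 : y ^ (1 - (k : ℝ)) = y ^ (-(k : ℝ)) * y := by
          rw [← Real.rpow_add_one hy.ne']; congr 1; ring
        have e2 : (1 : ℝ) - ((k + 1 : ℕ) : ℝ) = -(k : ℝ) := by push_cast; ring
        simp only [Pi.add_apply]
        rw [e1, e2]
        ring

lemma exists_antideriv_rpow_neg_mul_add_log (k : ℕ) {g₀ g₁ : ℝ → ℝ}
    (hg₀ : ContDiff ℝ ∞ g₀) (hg₁ : ContDiff ℝ ∞ g₁) :
    ∃ h₀ h₁ : ℝ → ℝ, ContDiff ℝ ∞ h₀ ∧ ContDiff ℝ ∞ h₁ ∧ ∀ x, 0 < x →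
      HasDerivAt (fun x => x ^ (1 - (k : ℝ)) * h₀ x + Real.log x * h₁ x)
        (x ^ (-(k : ℝ)) * g₀ x + Real.log x * g₁ x) x := by
  obtain ⟨c, h, hh, hd⟩ := exists_antideriv_rpow_neg_mul k hg₀
  obtain ⟨h₀, h₁, hh₀, hh₁, hd'⟩ :=
    exists_antideriv_add_pow_mul_log 0 (g₀ := fun _ => 0) contDiff_const hg₁
  refine ⟨fun x => h x + x ^ k * h₀ x, fun x => c + x * h₁ x,
    hh.add ((contDiff_id.pow k).mul hh₀), contDiff_const.add (contDiff_id.mul hh₁),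
    fun x hx => ?_⟩
  refine (((hd x hx).add (hd' x hx)).congr_deriv (by simp)).congr_of_eventuallyEq ?_
  filter_upwards [lt_mem_nhds hx] with y hy
  have e1 : y ^ (1 - (k : ℝ)) * y ^ k = y := by
    rw [← Real.rpow_natCast y k, ← Real.rpow_add hy]; simp
  simp only [Pi.add_apply, zero_add, pow_one]
  linear_combination h₀ y * e1

end Antiderivatives

section LogClass

open scoped ContDiff

/-- Functions on `(0, π/2]` of the form `θ^p g₀(θ) + θ^r log(θ) g₁(θ)` with `g₀, g₁` smooth up to
the boundary. -/
def LogClass (p r : ℝ) (u : ℝ → ℝ) : Prop :=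
  ∃ g₀ g₁ : ℝ → ℝ, ContDiff ℝ ∞ g₀ ∧ ContDiff ℝ ∞ g₁ ∧
    ∀ θ ∈ Set.Ioc 0 (Real.pi / 2), u θ = θ ^ p * g₀ θ + θ ^ r * Real.log θ * g₁ θ

variable {p r : ℝ} {u v f g : ℝ → ℝ}

lemma LogClass.congr (hu : LogClass p r u) (h : EqOn v u (Set.Ioc 0 (Real.pi / 2))) :
    LogClass p r v := by
  obtain ⟨g₀, g₁, h₀, h₁, e⟩ := hu
  exact ⟨g₀, g₁, h₀, h₁, fun θ hθ => (h hθ).trans (e θ hθ)⟩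

lemma LogClass.add (hu : LogClass p r u) (hv : LogClass p r v) :
    LogClass p r (fun θ => u θ + v θ) := by
  obtain ⟨g₀, g₁, h₀, h₁, e⟩ := hu
  obtain ⟨g₀', g₁', h₀', h₁', e'⟩ := hv
  refine ⟨_, _, h₀.add h₀', h₁.add h₁', fun θ hθ => ?_⟩
  dsimp only
  rw [e θ hθ, e' θ hθ]; ring

lemma LogClass.smooth_mul (hg : ContDiff ℝ ∞ g) (hu : LogClass p r u) :
    LogClass p r (fun θ => g θ * u θ) := by
  obtain ⟨g₀, g₁, h₀, h₁, e⟩ := hu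
  refine ⟨_, _, hg.mul h₀, hg.mul h₁, fun θ hθ => ?_⟩
  dsimp only
  rw [e θ hθ]; ring

lemma LogClass.const_mul (c : ℝ) (hu : LogClass p r u) : LogClass p r (fun θ => c * u θ) :=
  hu.smooth_mul contDiff_const

lemma LogClass.sub (hu : LogClass p r u) (hv : LogClass p r v) :
    LogClass p r (fun θ => u θ - v θ) :=
  (hu.add (hv.const_mul (-1))).congr fun θ _ => by ring

lemma logClass_zero : LogClass p r (fun _ => 0) :=
  ⟨fun _ => 0, fun _ => 0, contDiff_const, contDiff_const, by simp⟩

lemma LogClass.mono {p' r' : ℝ} (i j : ℕ) (hp : p = p' + i) (hr : r = r' + j)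
    (hu : LogClass p r u) : LogClass p' r' u := by
  obtain ⟨g₀, g₁, h₀, h₁, e⟩ := hu
  refine ⟨_, _, (contDiff_id.pow i).mul h₀, (contDiff_id.pow j).mul h₁, fun θ hθ => ?_⟩
  rw [e θ hθ, hp, hr, Real.rpow_add_natCast hθ.1.ne', Real.rpow_add_natCast hθ.1.ne']
  simp only [id]
  ring

lemma LogClass.id_mul (hu : LogClass p r u) : LogClass (p + 1) (r + 1) (fun θ => θ * u θ) := by
  obtain ⟨g₀, g₁, h₀, h₁, e⟩ := hu
  refine ⟨_, _, h₀, h₁, fun θ hθ => ?_⟩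
  dsimp only
  rw [e θ hθ, Real.rpow_add_one hθ.1.ne', Real.rpow_add_one hθ.1.ne']
  ring

lemma LogClass.sin_mul (hu : LogClass p r u) :
    LogClass (p + 1) (r + 1) (fun θ => Real.sin θ * u θ) := by
  obtain ⟨S, hS, -, -, hsin⟩ := exists_smooth_sin_eq_mul
  refine (hu.id_mul.smooth_mul hS).congr fun θ hθ => ?_
  dsimp only
  rw [hsin θ ⟨hθ.1.le, hθ.2⟩]; ring

lemma LogClass.sin_sq_mul (hu : LogClass p r u) :
    LogClass (p + 1) (r + 1) (fun θ => Real.sin θ ^ 2 * u θ) :=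
  (hu.sin_mul.smooth_mul Real.contDiff_sin).congr fun θ _ => by ring

lemma hasDerivAt_rpow_mul_add_log {g₀ g₁ : ℝ → ℝ} (h₀ : ContDiff ℝ ∞ g₀) (h₁ : ContDiff ℝ ∞ g₁)
    {θ : ℝ} (hθ : 0 < θ) :
    HasDerivAt (fun θ => θ ^ p * g₀ θ + θ ^ r * Real.log θ * g₁ θ)
      (θ⁻¹ * (θ ^ p * (p * g₀ θ + θ * deriv g₀ θ) + θ ^ r * g₁ θ
        + θ ^ r * Real.log θ * (r * g₁ θ + θ * deriv g₁ θ))) θ := by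
  have d₀ := ((contDiff_infty_iff_deriv.1 h₀).1 θ).hasDerivAt
  have d₁ := ((contDiff_infty_iff_deriv.1 h₁).1 θ).hasDerivAt
  refine (((Real.hasDerivAt_rpow_const (p := p) (Or.inl hθ.ne')).mul d₀).add
    (((Real.hasDerivAt_rpow_const (p := r) (Or.inl hθ.ne')).mul
      (Real.hasDerivAt_log hθ.ne')).mul d₁)).congr_deriv ?_
  simp only [Pi.mul_apply]
  rw [Real.rpow_sub_one hθ.ne', Real.rpow_sub_one hθ.ne']
  field_simp
  ring

lemma uniqueDiffOn_Ioc_pi : UniqueDiffOn ℝ (Set.Ioc 0 (Real.pi / 2)) := uniqueDiffOn_Ioc _ _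

lemma dW_eq_of_hasDerivAt {F : ℝ → ℝ} {θ d : ℝ} (h : EqOn u F (Set.Ioc 0 (Real.pi / 2)))
    (hθ : θ ∈ Set.Ioc 0 (Real.pi / 2)) (hF : HasDerivAt F d θ) : dW u θ = d :=
  ((hF.hasDerivWithinAt.congr h (h hθ)).derivWithin (uniqueDiffOn_Ioc_pi θ hθ))

lemma dW_congr (h : EqOn u v (Set.Ioc 0 (Real.pi / 2))) :
    EqOn (dW u) (dW v) (Set.Ioc 0 (Real.pi / 2)) :=
  fun _ hθ => derivWithin_congr h (h hθ)

lemma LogClass.contDiffOn (hu : LogClass p r u) :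
    ContDiffOn ℝ ∞ u (Set.Ioc 0 (Real.pi / 2)) := by
  obtain ⟨g₀, g₁, h₀, h₁, e⟩ := hu
  refine ContDiffOn.congr (fun θ hθ => ContDiffAt.contDiffWithinAt ?_) e
  exact ((Real.contDiffAt_rpow_const_of_ne hθ.1.ne').mul h₀.contDiffAt).add
    (((Real.contDiffAt_rpow_const_of_ne hθ.1.ne').mul (Real.contDiffAt_log.2 hθ.1.ne')).mul
      h₁.contDiffAt)

lemma LogClass.sin_mul_dW (j : ℕ) (hr : r = p + j) (hu : LogClass p r u) :
    LogClass p r (fun θ => Real.sin θ * dW u θ) := by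
  obtain ⟨S, hS, -, -, hsin⟩ := exists_smooth_sin_eq_mul
  obtain ⟨g₀, g₁, h₀, h₁, e⟩ := hu
  have h₀' := (contDiff_infty_iff_deriv.1 h₀).2
  have h₁' := (contDiff_infty_iff_deriv.1 h₁).2
  refine ⟨fun θ => S θ * (p * g₀ θ + θ * deriv g₀ θ + θ ^ j * g₁ θ),
    fun θ => S θ * (r * g₁ θ + θ * deriv g₁ θ), by fun_prop, by fun_prop, fun θ hθ => ?_⟩
  have hj : θ ^ r = θ ^ p * θ ^ j := by rw [hr, Real.rpow_add_natCast hθ.1.ne']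
  dsimp only
  rw [dW_eq_of_hasDerivAt e hθ (hasDerivAt_rpow_mul_add_log h₀ h₁ hθ.1),
    hsin θ ⟨hθ.1.le, hθ.2⟩]
  have := hθ.1.ne'
  field_simp
  rw [hj]
  ring

end LogClass

section Ladder

open scoped ContDiff

/-- The first-order operator `a cos θ - sin θ d/dθ` on `(0, π/2]`. -/
noncomputable def ladder (a : ℝ) (u : ℝ → ℝ) (θ : ℝ) : ℝ :=
  a * Real.cos θ * u θ - Real.sin θ * dW u θ

variable {p r a : ℝ} {u v f : ℝ → ℝ}

lemma hasDerivWithinAt_dW (hu : ContDiffOn ℝ ∞ u (Set.Ioc 0 (Real.pi / 2))) {θ : ℝ}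
    (hθ : θ ∈ Set.Ioc 0 (Real.pi / 2)) :
    HasDerivWithinAt u (dW u θ) (Set.Ioc 0 (Real.pi / 2)) θ :=
  (hu.differentiableOn (by simp) θ hθ).hasDerivWithinAt

lemma dW_eq_of_hasDerivWithinAt {θ d : ℝ} (hθ : θ ∈ Set.Ioc 0 (Real.pi / 2))
    (h : HasDerivWithinAt u d (Set.Ioc 0 (Real.pi / 2)) θ) : dW u θ = d :=
  h.derivWithin (uniqueDiffOn_Ioc_pi θ hθ)

lemma contDiffOn_dW (hu : ContDiffOn ℝ ∞ u (Set.Ioc 0 (Real.pi / 2))) :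
    ContDiffOn ℝ ∞ (dW u) (Set.Ioc 0 (Real.pi / 2)) :=
  hu.derivWithin uniqueDiffOn_Ioc_pi (by simp)

lemma ladder_congr (a : ℝ) (h : EqOn u v (Set.Ioc 0 (Real.pi / 2))) :
    EqOn (ladder a u) (ladder a v) (Set.Ioc 0 (Real.pi / 2)) := fun θ hθ => by
  simp only [ladder, h hθ, dW_congr h hθ]

lemma IopW_congr (n : ℕ) (s ν : ℝ) (h : EqOn u v (Set.Ioc 0 (Real.pi / 2))) :
    EqOn (IopW n s ν u) (IopW n s ν v) (Set.Ioc 0 (Real.pi / 2)) := fun θ hθ => by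
  simp only [IopW, h hθ, dW_congr h hθ, dW_congr (dW_congr h) hθ]

lemma dW_add_const_mul (c : ℝ) (hu : ContDiffOn ℝ ∞ u (Set.Ioc 0 (Real.pi / 2)))
    (hv : ContDiffOn ℝ ∞ v (Set.Ioc 0 (Real.pi / 2))) :
    EqOn (dW fun θ => u θ + c * v θ) (fun θ => dW u θ + c * dW v θ)
      (Set.Ioc 0 (Real.pi / 2)) := fun _ hθ =>
  dW_eq_of_hasDerivWithinAt hθ
    ((hasDerivWithinAt_dW hu hθ).add ((hasDerivWithinAt_dW hv hθ).const_mul c))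

lemma ladder_add_const_mul (a c : ℝ) (hu : ContDiffOn ℝ ∞ u (Set.Ioc 0 (Real.pi / 2)))
    (hv : ContDiffOn ℝ ∞ v (Set.Ioc 0 (Real.pi / 2))) :
    EqOn (ladder a fun θ => u θ + c * v θ) (fun θ => ladder a u θ + c * ladder a v θ)
      (Set.Ioc 0 (Real.pi / 2)) := fun θ hθ => by
  have h := dW_add_const_mul c hu hv hθ
  simp only [ladder, h]
  ring

lemma IopW_add_const_mul (n : ℕ) (s ν c : ℝ)
    (hu : ContDiffOn ℝ ∞ u (Set.Ioc 0 (Real.pi / 2)))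
    (hv : ContDiffOn ℝ ∞ v (Set.Ioc 0 (Real.pi / 2))) :
    EqOn (IopW n s ν fun θ => u θ + c * v θ) (fun θ => IopW n s ν u θ + c * IopW n s ν v θ)
      (Set.Ioc 0 (Real.pi / 2)) := fun θ hθ => by
  have h := dW_add_const_mul c hu hv
  have h' := (dW_congr h hθ).trans (dW_add_const_mul c (contDiffOn_dW hu) (contDiffOn_dW hv) hθ)
  simp only [IopW, h hθ, h']
  ring

lemma dW_zero (θ : ℝ) : dW (fun _ => 0) θ = 0 := by simp [dW]

lemma dW_const_mul (c : ℝ) (hu : ContDiffOn ℝ ∞ u (Set.Ioc 0 (Real.pi / 2))) :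
    EqOn (dW fun θ => c * u θ) (fun θ => c * dW u θ) (Set.Ioc 0 (Real.pi / 2)) := fun _ hθ =>
  dW_eq_of_hasDerivWithinAt hθ ((hasDerivWithinAt_dW hu hθ).const_mul c)

lemma ladder_const_mul (a c : ℝ) (hu : ContDiffOn ℝ ∞ u (Set.Ioc 0 (Real.pi / 2))) :
    EqOn (ladder a fun θ => c * u θ) (fun θ => c * ladder a u θ)
      (Set.Ioc 0 (Real.pi / 2)) := fun θ hθ => by
  have h := dW_const_mul c hu hθ
  simp only [ladder, h]
  ring

lemma IopW_const_mul (n : ℕ) (s ν c : ℝ) (hu : ContDiffOn ℝ ∞ u (Set.Ioc 0 (Real.pi / 2))) :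
    EqOn (IopW n s ν fun θ => c * u θ) (fun θ => c * IopW n s ν u θ)
      (Set.Ioc 0 (Real.pi / 2)) := fun θ hθ => by
  have h := dW_const_mul c hu
  have h' := (dW_congr h hθ).trans (dW_const_mul c (contDiffOn_dW hu) hθ)
  simp only [IopW, h hθ, h']
  ring

lemma IopW_zero (n : ℕ) (s ν θ : ℝ) : IopW n s ν (fun _ => 0) θ = 0 := by
  have : dW (fun _ => 0) = fun _ => 0 := funext dW_zero
  simp [IopW, this]

lemma hasDerivWithinAt_ladder (a : ℝ) (hu : ContDiffOn ℝ ∞ u (Set.Ioc 0 (Real.pi / 2))) {θ : ℝ}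
    (hθ : θ ∈ Set.Ioc 0 (Real.pi / 2)) :
    HasDerivWithinAt (ladder a u) ((a - 1) * Real.cos θ * dW u θ - a * Real.sin θ * u θ
      - Real.sin θ * dW (dW u) θ) (Set.Ioc 0 (Real.pi / 2)) θ := by
  have h1 := (((Real.hasDerivAt_cos θ).const_mul a).hasDerivWithinAt
    (s := Set.Ioc 0 (Real.pi / 2))).mul (hasDerivWithinAt_dW hu hθ)
  have h2 := ((Real.hasDerivAt_sin θ).hasDerivWithinAt
    (s := Set.Ioc 0 (Real.pi / 2))).mul (hasDerivWithinAt_dW (contDiffOn_dW hu) hθ)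
  exact (h1.sub h2).congr_deriv (by ring)

/-- Factorisation of the indicial operator into first-order operators. -/
lemma ladder_ladder (n : ℕ) (s ν : ℝ) (hu : ContDiffOn ℝ ∞ u (Set.Ioc 0 (Real.pi / 2))) :
    EqOn (ladder (n - ν) (ladder ν u))
      (fun θ => IopW n s ν u θ - (ν - s) * (ν + s - n) * u θ) (Set.Ioc 0 (Real.pi / 2)) := by
  intro θ hθ
  dsimp only
  rw [ladder, dW_eq_of_hasDerivWithinAt hθ (hasDerivWithinAt_ladder ν hu hθ)]
  simp only [IopW, ladder]
  linear_combination (ν * (n - ν) * u θ) * Real.sin_sq_add_cos_sq θ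

/-- Factorisation of the indicial operator with the factors in the opposite order. -/
lemma ladder_ladder' (n : ℕ) (s ν : ℝ) (hu : ContDiffOn ℝ ∞ u (Set.Ioc 0 (Real.pi / 2))) :
    EqOn (ladder (ν + 1) (ladder (n - (ν + 1)) u))
      (fun θ => IopW n s ν u θ - (ν + 1 - s) * (ν + 1 + s - n) * u θ)
      (Set.Ioc 0 (Real.pi / 2)) := by
  intro θ hθ
  have h := ladder_ladder n s (n - (ν + 1)) hu hθ
  rw [sub_sub_cancel] at h
  rw [h]
  simp only [IopW]
  ring

lemma logClass_ladder (a : ℝ) (j : ℕ) (hr : r = p + j) (hu : LogClass p r u) :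
    LogClass p r (ladder a u) :=
  ((hu.smooth_mul Real.contDiff_cos).const_mul a |>.sub (hu.sin_mul_dW j hr)).congr
    fun θ _ => by simp only [ladder]; ring

/-- At the indicial exponent the first-order operator gains one order in the logarithmic part. -/
lemma logClass_ladder_raise (j : ℕ) (hr : r = p + j) (hu : LogClass p r u) :
    LogClass p (r + 1) (ladder r u) := by
  obtain ⟨S, hS, -, hS0, hsin⟩ := exists_smooth_sin_eq_mul
  obtain ⟨g₀, g₁, h₀, h₁, e⟩ := hu
  have h₀' := (contDiff_infty_iff_deriv.1 h₀).2
  have h₁' := (contDiff_infty_iff_deriv.1 h₁).2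
  obtain ⟨K, hK, hcos⟩ := exists_smooth_eq_add_mul (Real.contDiff_cos.sub hS)
  simp only [hS0, Real.cos_zero, sub_self, zero_add] at hcos
  refine ⟨fun θ => r * Real.cos θ * g₀ θ - S θ * (p * g₀ θ + θ * deriv g₀ θ + θ ^ j * g₁ θ),
    fun θ => r * K θ * g₁ θ - S θ * deriv g₁ θ, by fun_prop, by fun_prop, fun θ hθ => ?_⟩
  have hj : θ ^ r = θ ^ p * θ ^ j := by rw [hr, Real.rpow_add_natCast hθ.1.ne']
  dsimp only [ladder]
  rw [dW_eq_of_hasDerivAt e hθ (hasDerivAt_rpow_mul_add_log h₀ h₁ hθ.1), e θ hθ,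
    hsin θ ⟨hθ.1.le, hθ.2⟩, Real.rpow_add_one hθ.1.ne', hj]
  have h1 := hcos θ
  have h2 := mul_inv_cancel₀ hθ.1.ne'
  linear_combination (θ ^ p * θ ^ j * Real.log θ * r * g₁ θ) * h1
    - (S θ * (θ ^ p * (p * g₀ θ + θ * deriv g₀ θ) + θ ^ p * θ ^ j * g₁ θ
        + θ ^ p * θ ^ j * Real.log θ * (r * g₁ θ + θ * deriv g₁ θ))) * h2

/-- If `sin^{-a-1} f` has an antiderivative `-y`, then `sin^a y` solves `ladder a u = f`. -/
lemma ladder_rpow_mul {S y : ℝ → ℝ} (hS0 : ∀ x, 0 < S x)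
    (hsin : ∀ x ∈ Set.Icc 0 (Real.pi / 2), Real.sin x = x * S x)
    {θ d : ℝ} (hθ : θ ∈ Set.Ioc 0 (Real.pi / 2)) (hy : HasDerivAt y d θ) :
    ladder a (fun θ => θ ^ a * S θ ^ a * y θ) θ = - (θ ^ (a + 1) * S θ ^ (a + 1) * d) := by
  have hpi := Real.pi_pos
  have hs : 0 < Real.sin θ := Real.sin_pos_of_pos_of_lt_pi hθ.1 (by linarith [hθ.2])
  have hpow : ∀ b : ℝ, ∀ x ∈ Set.Ioc 0 (Real.pi / 2), x ^ b * S x ^ b = Real.sin x ^ b :=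
    fun b x hx => by rw [hsin x ⟨hx.1.le, hx.2⟩, Real.mul_rpow hx.1.le (hS0 x).le]
  have h1 : EqOn (fun θ => θ ^ a * S θ ^ a * y θ) (fun θ => Real.sin θ ^ a * y θ)
      (Set.Ioc 0 (Real.pi / 2)) := fun x hx => by simp only [hpow a x hx]
  have h2 : HasDerivAt (fun θ => Real.sin θ ^ a * y θ) _ θ :=
    ((Real.hasDerivAt_sin θ).rpow_const (p := a) (Or.inl hs.ne')).mul hy
  rw [ladder_congr a h1 hθ, ladder, dW_eq_of_hasDerivAt (fun _ _ => rfl) hθ h2, hpow _ θ hθ,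
    Real.rpow_sub_one hs.ne', Real.rpow_add_one hs.ne']
  field_simp
  ring

lemma exists_ladder_eq_of_subcritical (k : ℕ) (hf : LogClass (a + 1) (a + k + 1) f) :
    ∃ u, LogClass (a + 1) (a + k + 1) u ∧ EqOn (ladder a u) f (Set.Ioc 0 (Real.pi / 2)) := by
  obtain ⟨S, hS, hS0, -, hsin⟩ := exists_smooth_sin_eq_mul
  obtain ⟨g₀, g₁, h₀, h₁, e⟩ := hf
  have hSp : ∀ b : ℝ, ContDiff ℝ ∞ fun x => S x ^ b := fun b =>
    hS.rpow_const_of_ne fun x => (hS0 x).ne'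
  obtain ⟨y₀, y₁, hy₀, hy₁, hy⟩ := exists_antideriv_add_pow_mul_log k
    ((hSp (-(a + 1))).mul h₀).neg ((hSp (-(a + 1))).mul h₁).neg
  refine ⟨_, ⟨_, _, (hSp a).mul hy₀, (hSp a).mul hy₁, fun θ _ => rfl⟩, fun θ hθ => ?_⟩
  have hp := hθ.1.ne'
  have h1 : EqOn (fun θ => θ ^ (a + 1) * (S θ ^ a * y₀ θ)
      + θ ^ (a + k + 1) * Real.log θ * (S θ ^ a * y₁ θ))
      (fun θ => θ ^ a * S θ ^ a * (θ * y₀ θ + θ ^ (k + 1) * Real.log θ * y₁ θ))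
      (Set.Ioc 0 (Real.pi / 2)) := fun x hx => by
    dsimp only
    rw [Real.rpow_add_one hx.1.ne', Real.rpow_add_one hx.1.ne', Real.rpow_add_natCast hx.1.ne']
    ring
  rw [ladder_congr a h1 hθ, ladder_rpow_mul hS0 hsin hθ (hy θ hθ.1), e θ hθ,
    Real.rpow_add_one hp, Real.rpow_add_one hp, Real.rpow_add_natCast hp,
    Real.rpow_neg (hS0 θ).le]
  have := (Real.rpow_pos_of_pos (hS0 θ) (a + 1)).ne'
  field_simp
  ring

lemma exists_ladder_eq_of_critical (k : ℕ) (hf : LogClass (a - k + 1) (a + 1) f) :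
    ∃ u, LogClass (a - k + 1) a u ∧ EqOn (ladder a u) f (Set.Ioc 0 (Real.pi / 2)) := by
  obtain ⟨S, hS, hS0, -, hsin⟩ := exists_smooth_sin_eq_mul
  obtain ⟨g₀, g₁, h₀, h₁, e⟩ := hf
  have hSp : ∀ b : ℝ, ContDiff ℝ ∞ fun x => S x ^ b := fun b =>
    hS.rpow_const_of_ne fun x => (hS0 x).ne'
  obtain ⟨y₀, y₁, hy₀, hy₁, hy⟩ := exists_antideriv_rpow_neg_mul_add_log k
    ((hSp (-(a + 1))).mul h₀).neg ((hSp (-(a + 1))).mul h₁).neg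
  refine ⟨_, ⟨_, _, (hSp a).mul hy₀, (hSp a).mul hy₁, fun θ _ => rfl⟩, fun θ hθ => ?_⟩
  have hp := hθ.1.ne'
  have h1 : EqOn (fun θ => θ ^ (a - k + 1) * (S θ ^ a * y₀ θ)
      + θ ^ a * Real.log θ * (S θ ^ a * y₁ θ))
      (fun θ => θ ^ a * S θ ^ a * (θ ^ (1 - (k : ℝ)) * y₀ θ + Real.log θ * y₁ θ))
      (Set.Ioc 0 (Real.pi / 2)) := fun x hx => by
    have : x ^ (a - k + 1) = x ^ a * x ^ (1 - (k : ℝ)) := by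
      rw [← Real.rpow_add hx.1]; congr 1; ring
    dsimp only
    rw [this]
    ring
  have h2 : θ ^ (a - k + 1) = θ ^ (a + 1) * θ ^ (-(k : ℝ)) := by
    rw [← Real.rpow_add hθ.1]; congr 1; ring
  rw [ladder_congr a h1 hθ, ladder_rpow_mul hS0 hsin hθ (hy θ hθ.1), e θ hθ, h2,
    Real.rpow_neg (hS0 θ).le]
  have := (Real.rpow_pos_of_pos (hS0 θ) (a + 1)).ne'
  field_simp
  ring

end Ladder

section Asymptotics

open scoped ContDiff Topology

variable {p r a : ℝ} {u v f : ℝ → ℝ}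

lemma Ioc_pi_mem_nhdsGT_zero : Set.Ioc 0 (Real.pi / 2) ∈ 𝓝[>] (0 : ℝ) :=
  Ioc_mem_nhdsGT Real.pi_div_two_pos

lemma tendsto_rpow_neg_mul_of_eq {g₀ g₁ : ℝ → ℝ} (h₀ : ContDiff ℝ ∞ g₀) (h₁ : ContDiff ℝ ∞ g₁)
    (e : ∀ θ ∈ Set.Ioc 0 (Real.pi / 2), u θ = θ ^ p * g₀ θ + θ ^ r * Real.log θ * g₁ θ)
    (hpr : p < r) :
    Tendsto (fun θ => θ ^ (-p) * u θ) (𝓝[>] 0) (𝓝 (g₀ 0)) := by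
  have t₀ : Tendsto g₀ (𝓝[>] 0) (𝓝 (g₀ 0)) := h₀.continuous.continuousAt.mono_left inf_le_left
  have t₁ : Tendsto g₁ (𝓝[>] 0) (𝓝 (g₁ 0)) := h₁.continuous.continuousAt.mono_left inf_le_left
  have t := t₀.add ((tendsto_log_mul_rpow_nhdsGT_zero (sub_pos.2 hpr)).mul t₁)
  rw [zero_mul, add_zero] at t
  refine t.congr' ?_
  filter_upwards [Ioc_pi_mem_nhdsGT_zero] with θ hθ
  rw [e θ hθ, sub_eq_neg_add, Real.rpow_add hθ.1, Real.rpow_neg hθ.1.le]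
  have := (Real.rpow_pos_of_pos hθ.1 p).ne'
  field_simp

lemma LogClass.exists_tendsto (hu : LogClass p r u) (hpr : p < r) :
    ∃ L, Tendsto (fun θ => θ ^ (-p) * u θ) (𝓝[>] 0) (𝓝 L) := by
  obtain ⟨g₀, g₁, h₀, h₁, e⟩ := hu
  exact ⟨_, tendsto_rpow_neg_mul_of_eq h₀ h₁ e hpr⟩

lemma LogClass.tendsto_zero (hu : LogClass (a + 1) r u) (har : a < r) :
    Tendsto (fun θ => θ ^ (-a) * u θ) (𝓝[>] 0) (𝓝 0) := by
  obtain ⟨g₀, g₁, h₀, h₁, e⟩ := hu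
  have h := tendsto_rpow_neg_mul_of_eq (u := u) (p := a) (r := r) (contDiff_id.mul h₀) h₁
    (fun θ hθ => by rw [e θ hθ, Real.rpow_add_one hθ.1.ne']; simp only [id]; ring) har
  simpa using h

lemma sin_pos_of_mem_Ioc_pi {θ : ℝ} (hθ : θ ∈ Set.Ioc 0 (Real.pi / 2)) : 0 < Real.sin θ :=
  Real.sin_pos_of_pos_of_lt_pi hθ.1 (by linarith [hθ.2, Real.pi_pos])

lemma pi_div_two_mem_Ioc : Real.pi / 2 ∈ Set.Ioc 0 (Real.pi / 2) :=
  ⟨Real.pi_div_two_pos, le_rfl⟩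

lemma exists_eq_sin_rpow_of_ladder_eq_zero (hu : ContDiffOn ℝ ∞ u (Set.Ioc 0 (Real.pi / 2)))
    (h : EqOn (ladder a u) (fun _ => 0) (Set.Ioc 0 (Real.pi / 2))) :
    ∃ c, EqOn u (fun θ => c * Real.sin θ ^ a) (Set.Ioc 0 (Real.pi / 2)) := by
  have hd : ∀ θ ∈ Set.Ioc 0 (Real.pi / 2), HasDerivWithinAt (fun θ => Real.sin θ ^ (-a) * u θ) 0
      (Set.Ioc 0 (Real.pi / 2)) θ := fun θ hθ => by
    have hs := sin_pos_of_mem_Ioc_pi hθ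
    refine ((((Real.hasDerivAt_sin θ).rpow_const (p := -a)
      (Or.inl hs.ne')).hasDerivWithinAt).mul (hasDerivWithinAt_dW hu hθ)).congr_deriv ?_
    have h1 := h hθ
    simp only [ladder] at h1
    rw [Real.rpow_sub_one hs.ne']
    field_simp
    linear_combination (-(Real.sin θ ^ (-a))) * h1
  refine ⟨Real.sin (Real.pi / 2) ^ (-a) * u (Real.pi / 2), fun θ hθ => ?_⟩
  have h1 := (convex_Ioc (0 : ℝ) (Real.pi / 2)).is_const_of_fderivWithin_eq_zero (𝕜 := ℝ)
    (fun θ hθ => (hd θ hθ).differentiableWithinAt)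
    (fun θ hθ => by
      rw [(hd θ hθ).hasFDerivWithinAt.fderivWithin (uniqueDiffOn_Ioc_pi θ hθ)]; simp)
    hθ pi_div_two_mem_Ioc
  have hs := sin_pos_of_mem_Ioc_pi hθ
  dsimp only at h1 ⊢
  rw [← h1, Real.rpow_neg hs.le]
  have := (Real.rpow_pos_of_pos hs a).ne'
  field_simp

lemma eqOn_zero_of_ladder_eq_zero (hu : LogClass (a + 1) r u) (har : a < r)
    (h : EqOn (ladder a u) (fun _ => 0) (Set.Ioc 0 (Real.pi / 2))) :
    EqOn u (fun _ => 0) (Set.Ioc 0 (Real.pi / 2)) := by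
  obtain ⟨c, hc⟩ := exists_eq_sin_rpow_of_ladder_eq_zero hu.contDiffOn h
  obtain ⟨S, hS, hS0, hS1, hsin⟩ := exists_smooth_sin_eq_mul
  have h1 : Tendsto (fun θ => c * S θ ^ a) (𝓝[>] 0) (𝓝 (c * S 0 ^ a)) :=
    ((hS.rpow_const_of_ne fun x => (hS0 x).ne').continuous.const_mul c).continuousAt.mono_left
      inf_le_left
  have h2 : Tendsto (fun θ => c * S θ ^ a) (𝓝[>] 0) (𝓝 0) := by
    refine (hu.tendsto_zero har).congr' ?_
    filter_upwards [Ioc_pi_mem_nhdsGT_zero] with θ hθ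
    rw [hc hθ]
    dsimp only
    rw [hsin θ ⟨hθ.1.le, hθ.2⟩, Real.mul_rpow hθ.1.le (hS0 θ).le, Real.rpow_neg hθ.1.le]
    have := (Real.rpow_pos_of_pos hθ.1 a).ne'
    field_simp
  have h3 := tendsto_nhds_unique h1 h2
  rw [hS1, Real.one_rpow, mul_one] at h3
  intro θ hθ
  rw [hc hθ, h3]
  exact zero_mul _

lemma memA0_iff {n : ℕ} {s : ℝ} {j : ℕ} (hj : s = n - s + 1 + j) :
    memA0 n s u ↔ LogClass (n - s + 1) s u ∧ dW u (Real.pi / 2) = 0 := by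
  have hlt : (n : ℝ) - s < s := by
    have : (0 : ℝ) ≤ j := j.cast_nonneg
    linarith
  constructor
  · rintro ⟨⟨g₀, g₁, h₀, h₁, e⟩, ht, hd⟩
    refine ⟨?_, hd⟩
    have h := tendsto_rpow_neg_mul_of_eq h₀ h₁ e hlt
    rw [neg_sub] at h
    have h0 := tendsto_nhds_unique h ht
    obtain ⟨K, hK, hK'⟩ := exists_smooth_eq_add_mul h₀
    refine ⟨K, g₁, hK, h₁, fun θ hθ => ?_⟩
    rw [e θ hθ, hK' θ, h0, Real.rpow_add_one hθ.1.ne']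
    ring
  · rintro ⟨hu, hd⟩
    refine ⟨?_, ?_, hd⟩
    · exact hu.mono 1 0 (by simp) (by simp)
    · have := hu.tendsto_zero hlt
      rwa [neg_sub] at this

end Asymptotics

section IndicialKernel

open scoped ContDiff Topology

variable {n j : ℕ} {s : ℝ} {u v f : ℝ → ℝ}

lemma exists_IopW_eq (hj : s = n - s + 1 + j) (q : ℕ) (hf : LogClass (n - s + 1) (s + 1) f) :
    ∃ u, LogClass (n - s + 1) s u ∧
      EqOn (IopW n s (s + q) u) f (Set.Ioc 0 (Real.pi / 2)) := by
  induction q generalizing f with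
  | zero =>
    have e1 : s + 1 = (n - s) + ((j + 1 : ℕ) : ℝ) + 1 := by push_cast; linarith
    have e2 : (n : ℝ) - s + 1 = s - ((j + 1 : ℕ) : ℝ) + 1 := by push_cast; linarith
    rw [e1] at hf
    obtain ⟨w, hw, hwf⟩ := exists_ladder_eq_of_subcritical (j + 1) hf
    rw [← e1, e2] at hw
    obtain ⟨u, hu, huw⟩ := exists_ladder_eq_of_critical (j + 1) hw
    rw [← e2] at hu
    refine ⟨u, hu, fun θ hθ => ?_⟩
    have h1 := ladder_ladder n s s hu.contDiffOn hθ
    rw [ladder_congr _ huw hθ, hwf hθ] at h1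
    simp only [sub_self, zero_mul, sub_zero] at h1
    rw [Nat.cast_zero, add_zero, h1]
  | succ q ih =>
    have hc : ((q : ℝ) + 1) * (s + q + 1 + s - n) ≠ 0 := by
      have h1 : s + q + 1 + s - n = q + 2 + j := by linarith
      rw [h1]
      positivity
    set c := ((q : ℝ) + 1) * (s + q + 1 + s - n) with hc_def
    have hjB : s + 1 = n - s + 1 + (j + 1 : ℕ) := by push_cast; linarith
    obtain ⟨w, hw, hwf⟩ := ih (logClass_ladder (s + q + 1) (j + 1) hjB hf)
    have hLw := logClass_ladder (n - (s + q + 1)) j hj hw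
    have hfA : LogClass (n - s + 1) s f := hf.mono 0 1 (by simp) (by simp)
    have hLwD := hLw.contDiffOn
    have hsub : LogClass (n - s + 1) s
        (fun θ => f θ + (-1) * ladder (n - (s + q + 1)) w θ) := hfA.add (hLw.const_mul _)
    have hAu : EqOn (ladder (s + q + 1)
        (fun θ => c⁻¹ * (f θ + (-1) * ladder (n - (s + q + 1)) w θ))) w
        (Set.Ioc 0 (Real.pi / 2)) := fun θ hθ => by
      rw [ladder_const_mul _ _ hsub.contDiffOn hθ]
      dsimp only
      rw [ladder_add_const_mul _ _ hf.contDiffOn hLwD hθ]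
      dsimp only
      rw [ladder_ladder' n s (s + q) hw.contDiffOn hθ]
      dsimp only
      rw [hwf hθ]
      field_simp
      rw [hc_def]
      ring
    refine ⟨_, hsub.const_mul c⁻¹, fun θ hθ => ?_⟩
    have h1 := ladder_ladder n s (s + q + 1) (hsub.const_mul c⁻¹).contDiffOn hθ
    rw [ladder_congr _ hAu hθ] at h1
    have h2 : s + ((q + 1 : ℕ) : ℝ) = s + q + 1 := by push_cast; ring
    have h3 : (s + q + 1 - s) * (s + q + 1 + s - n) = c := by rw [hc_def]; ring
    dsimp only at h1
    rw [h3, mul_inv_cancel_left₀ hc] at h1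
    rw [h2]
    linarith

/-- The solutions of `I_{s, s+q} β = 0` with leading behaviour `θ^s`. -/
noncomputable def indicialKernel (n : ℕ) (s : ℝ) : ℕ → ℝ → ℝ
  | 0 => fun θ => Real.sin θ ^ s
  | q + 1 => ladder (n - (s + q + 1)) (indicialKernel n s q)

lemma indicialKernel_logClass (q : ℕ) : LogClass s (s + 1) (indicialKernel n s q) := by
  induction q with
  | zero =>
    obtain ⟨S, hS, hS0, -, hsin⟩ := exists_smooth_sin_eq_mul
    refine ⟨fun θ => S θ ^ s, fun _ => 0, hS.rpow_const_of_ne fun x => (hS0 x).ne',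
      contDiff_const, fun θ hθ => ?_⟩
    rw [indicialKernel]
    dsimp only
    rw [hsin θ ⟨hθ.1.le, hθ.2⟩, Real.mul_rpow hθ.1.le (hS0 θ).le]
    ring
  | succ q ih => exact logClass_ladder _ 1 (by simp) ih

lemma indicialKernel_logClass' (hj : s = n - s + 1 + j) (q : ℕ) :
    LogClass (n - s + 1) s (indicialKernel n s q) :=
  (indicialKernel_logClass q).mono j 1 hj (by simp)

lemma ladder_sin_rpow :
    EqOn (ladder s fun θ => Real.sin θ ^ s) (fun _ => 0) (Set.Ioc 0 (Real.pi / 2)) := by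
  intro θ hθ
  have hs := sin_pos_of_mem_Ioc_pi hθ
  rw [ladder, dW_eq_of_hasDerivAt (fun _ _ => rfl) hθ
    ((Real.hasDerivAt_sin θ).rpow_const (p := s) (Or.inl hs.ne')), Real.rpow_sub_one hs.ne']
  field_simp
  ring

lemma IopW_indicialKernel (q : ℕ) : EqOn (IopW n s (s + q) (indicialKernel n s q)) (fun _ => 0)
    (Set.Ioc 0 (Real.pi / 2)) := by
  induction q with
  | zero =>
    intro θ hθ
    have h1 := ladder_ladder n s s (indicialKernel_logClass (n := n) (s := s) 0).contDiffOn hθ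
    have h2 := ladder_congr (n - s) (ladder_sin_rpow (s := s)) hθ
    rw [indicialKernel, h2] at h1
    simp only [ladder, dW_zero, sub_self, zero_mul, mul_zero, sub_zero] at h1
    rw [Nat.cast_zero, add_zero, indicialKernel, ← h1]
  | succ q ih =>
    intro θ hθ
    have hβ := (indicialKernel_logClass (n := n) (s := s) q).contDiffOn
    have hβ' := (indicialKernel_logClass (n := n) (s := s) (q + 1)).contDiffOn
    have h1 : EqOn (ladder (s + q + 1) (indicialKernel n s (q + 1)))
        (fun θ => (-((s + q + 1 - s) * (s + q + 1 + s - n))) * indicialKernel n s q θ)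
        (Set.Ioc 0 (Real.pi / 2)) := fun θ hθ => by
      rw [indicialKernel, ladder_ladder' n s (s + q) hβ hθ]
      dsimp only
      rw [ih hθ]
      ring
    have h2 := ladder_ladder n s (s + q + 1) hβ' hθ
    rw [ladder_congr _ h1 hθ, ladder_const_mul _ _ hβ hθ] at h2
    dsimp only at h2
    rw [show ladder (n - (s + q + 1)) (indicialKernel n s q) = indicialKernel n s (q + 1)
      from rfl] at h2
    have h3 : s + ((q + 1 : ℕ) : ℝ) = s + q + 1 := by push_cast; ring
    rw [h3]
    linarith

lemma factor_ne_zero (hj : s = n - s + 1 + j) (q : ℕ) :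
    (s + q + 1 - s) * (s + q + 1 + s - n) ≠ 0 := by
  have h1 : (s + q + 1 - s) * (s + q + 1 + s - n) = (q + 1) * (q + 2 + j) := by
    have : s + q + 1 + s - n = q + 2 + j := by linarith
    rw [this]; ring
  rw [h1]
  positivity

lemma indicialKernel_ne_zero (hj : s = n - s + 1 + j) (q : ℕ) :
    ∃ θ ∈ Set.Ioc 0 (Real.pi / 2), indicialKernel n s q θ ≠ 0 := by
  induction q with
  | zero =>
    exact ⟨Real.pi / 2, pi_div_two_mem_Ioc, by simp [indicialKernel]⟩
  | succ q ih =>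
    obtain ⟨θ, hθ, hne⟩ := ih
    by_contra! hzero
    have h1 := ladder_congr (v := fun _ => 0) (s + q + 1) hzero hθ
    rw [indicialKernel, ladder_ladder' n s (s + q)
      (indicialKernel_logClass (n := n) (s := s) q).contDiffOn hθ] at h1
    dsimp only at h1
    rw [IopW_indicialKernel q hθ] at h1
    simp only [ladder, dW_zero, mul_zero, sub_self, zero_sub, neg_eq_zero] at h1
    exact (mul_ne_zero (factor_ne_zero hj q) hne) h1

/-- The kernel of the indicial operator is one-dimensional. -/
lemma exists_eq_mul_indicialKernel (hj : s = n - s + 1 + j) (q : ℕ)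
    (hu : LogClass (n - s + 1) s u)
    (h : EqOn (IopW n s (s + q) u) (fun _ => 0) (Set.Ioc 0 (Real.pi / 2))) :
    ∃ t, EqOn u (fun θ => t * indicialKernel n s q θ) (Set.Ioc 0 (Real.pi / 2)) := by
  have hlt : (n : ℝ) - s < s := by
    have : (0 : ℝ) ≤ j := j.cast_nonneg
    linarith
  induction q generalizing u with
  | zero =>
    have hw := logClass_ladder s j hj hu
    have h1 : EqOn (ladder (n - s) (ladder s u)) (fun _ => 0) (Set.Ioc 0 (Real.pi / 2)) :=
      fun θ hθ => by
        have h2 := h hθ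
        rw [Nat.cast_zero, add_zero] at h2
        rw [ladder_ladder n s s hu.contDiffOn hθ]
        dsimp only
        rw [h2]; ring
    exact exists_eq_sin_rpow_of_ladder_eq_zero hu.contDiffOn
      (eqOn_zero_of_ladder_eq_zero hw hlt h1)
  | succ q ih =>
    have h3 : s + ((q + 1 : ℕ) : ℝ) = s + q + 1 := by push_cast; ring
    rw [h3] at h
    have hw := logClass_ladder (s + q + 1) j hj hu
    set c := (s + q + 1 - s) * (s + q + 1 + s - n) with hc_def
    have hc : c ≠ 0 := factor_ne_zero hj q
    have h1 : EqOn (ladder (n - (s + q + 1)) (ladder (s + q + 1) u)) (fun θ => (-c) * u θ)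
        (Set.Ioc 0 (Real.pi / 2)) := fun θ hθ => by
      rw [ladder_ladder n s (s + q + 1) hu.contDiffOn hθ]
      dsimp only
      rw [h hθ, hc_def]; ring
    have h2 : EqOn (IopW n s (s + q) (ladder (s + q + 1) u)) (fun _ => 0)
        (Set.Ioc 0 (Real.pi / 2)) := fun θ hθ => by
      have h4 := ladder_ladder' n s (s + q) hw.contDiffOn hθ
      rw [ladder_congr _ h1 hθ, ladder_const_mul _ _ hu.contDiffOn hθ] at h4
      dsimp only at h4 ⊢
      rw [← hc_def] at h4
      linarith
    obtain ⟨t, ht⟩ := ih hw h2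
    refine ⟨-(t / c), fun θ hθ => ?_⟩
    have h5 := h1 hθ
    rw [ladder_congr _ ht hθ,
      ladder_const_mul _ _ (indicialKernel_logClass (n := n) (s := s) q).contDiffOn hθ] at h5
    dsimp only at h5 ⊢
    rw [indicialKernel]
    field_simp
    linarith

lemma indicialKernel_pi_div_two (q : ℕ) :
    (Even q → dW (indicialKernel n s q) (Real.pi / 2) = 0) ∧
      (Odd q → indicialKernel n s q (Real.pi / 2) = 0) := by
  induction q with
  | zero =>
    refine ⟨fun _ => ?_, fun h => by simp at h⟩
    have h := ladder_sin_rpow (s := s) pi_div_two_mem_Ioc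
    rw [indicialKernel]
    simpa [ladder] using h
  | succ q ih =>
    have hβ := (indicialKernel_logClass (n := n) (s := s) q).contDiffOn
    refine ⟨fun hq => ?_, fun hq => ?_⟩
    · have hq' : Odd q := by
        rw [Nat.even_add_one, Nat.not_even_iff_odd] at hq; exact hq
      have h0 := ih.2 hq'
      have h1 := IopW_indicialKernel (n := n) (s := s) q pi_div_two_mem_Ioc
      simp only [IopW, Real.sin_pi_div_two, Real.cos_pi_div_two, h0] at h1
      have h2 := dW_eq_of_hasDerivWithinAt pi_div_two_mem_Ioc
        (hasDerivWithinAt_ladder (n - (s + q + 1)) hβ pi_div_two_mem_Ioc)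
      rw [indicialKernel, h2, Real.sin_pi_div_two, Real.cos_pi_div_two, h0]
      linarith
    · have hq' : Even q := by
        rw [Nat.odd_add_one, Nat.not_odd_iff_even] at hq; exact hq
      simp [indicialKernel, ladder, ih.1 hq']

end IndicialKernel

section Solvability

open scoped ContDiff Topology

variable {n j q : ℕ} {s c : ℝ} {u f : ℝ → ℝ}

/-- The weighted Wronskian of `β` and `u`, for which the indicial operator is formally
self-adjoint. -/
noncomputable def wronskianW (n : ℕ) (β u : ℝ → ℝ) (θ : ℝ) : ℝ :=
  Real.sin θ ^ (1 - n : ℝ) * (β θ * dW u θ - dW β θ * u θ)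

lemma hasDerivWithinAt_wronskianW {β : ℝ → ℝ} {ν : ℝ}
    (hβ : ContDiffOn ℝ ∞ β (Set.Ioc 0 (Real.pi / 2)))
    (hu : ContDiffOn ℝ ∞ u (Set.Ioc 0 (Real.pi / 2))) {θ : ℝ}
    (hθ : θ ∈ Set.Ioc 0 (Real.pi / 2)) :
    HasDerivWithinAt (wronskianW n β u)
      (Real.sin θ ^ (-1 - n : ℝ) * (β θ * IopW n s ν u θ - u θ * IopW n s ν β θ))
      (Set.Ioc 0 (Real.pi / 2)) θ := by
  have hs := sin_pos_of_mem_Ioc_pi hθ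
  refine ((((Real.hasDerivAt_sin θ).rpow_const (p := (1 - n : ℝ))
    (Or.inl hs.ne')).hasDerivWithinAt).mul
    (((hasDerivWithinAt_dW hβ hθ).mul (hasDerivWithinAt_dW (contDiffOn_dW hu) hθ)).sub
      ((hasDerivWithinAt_dW (contDiffOn_dW hβ) hθ).mul
        (hasDerivWithinAt_dW hu hθ)))).congr_deriv ?_
  have e1 : Real.sin θ ^ (1 - n : ℝ) = Real.sin θ ^ (-1 - n : ℝ) * Real.sin θ ^ 2 := by
    rw [← Real.rpow_natCast, ← Real.rpow_add hs]; congr 1; push_cast; ring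
  have e2 : Real.sin θ ^ (1 - n - 1 : ℝ) = Real.sin θ ^ (-1 - n : ℝ) * Real.sin θ := by
    rw [← Real.rpow_add_one hs.ne']; congr 1; ring
  simp only [Pi.mul_apply, Pi.sub_apply, IopW]
  rw [e1, e2]
  ring

lemma tendsto_wronskianW {β : ℝ → ℝ} (hj : s = n - s + 1 + j) (hβ : LogClass s (s + 1) β)
    (hu : LogClass (n - s + 1) s u) :
    Tendsto (wronskianW n β u) (𝓝[>] 0) (𝓝 0) := by
  have hlt : (n : ℝ) - s < s := by
    have : (0 : ℝ) ≤ j := j.cast_nonneg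
    linarith
  obtain ⟨S, hS, hS0, -, hsin⟩ := exists_smooth_sin_eq_mul
  obtain ⟨L, hL⟩ := hβ.exists_tendsto (lt_add_one s)
  obtain ⟨L', hL'⟩ := (hβ.sin_mul_dW 1 (by simp)).exists_tendsto (lt_add_one s)
  have hu0 := hu.tendsto_zero hlt
  have hu1 := (hu.sin_mul_dW j hj).tendsto_zero hlt
  have hSt : Tendsto (fun θ => S θ ^ (-n : ℝ)) (𝓝[>] 0) (𝓝 (S 0 ^ (-n : ℝ))) :=
    (hS.rpow_const_of_ne fun x => (hS0 x).ne').continuous.continuousAt.mono_left inf_le_left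
  have h := hSt.mul ((hL.mul hu1).sub (hL'.mul hu0))
  simp only [mul_zero, sub_zero] at h
  refine h.congr' ?_
  filter_upwards [Ioc_pi_mem_nhdsGT_zero] with θ hθ
  have hs := sin_pos_of_mem_Ioc_pi hθ
  have e1 : Real.sin θ ^ (1 - n : ℝ)
      = S θ ^ (-n : ℝ) * (θ ^ (-s) * θ ^ (-(n - s))) * Real.sin θ := by
    rw [← Real.rpow_add hθ.1, sub_eq_neg_add, Real.rpow_add_one hs.ne',
      show -s + -(n - s) = (-n : ℝ) by ring, mul_comm (S θ ^ _),
      ← Real.mul_rpow hθ.1.le (hS0 θ).le, ← hsin θ ⟨hθ.1.le, hθ.2⟩]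
  rw [wronskianW, e1]
  ring

/-- The function `sin² β`, for `β` in the kernel of the indicial operator, is not in the range of
the indicial operator with Neumann condition at `π/2`. -/
lemma eq_zero_of_IopW_eq_sin_sq_mul (hj : s = n - s + 1 + j) (hq : Even q)
    (hu : LogClass (n - s + 1) s u) (hd : dW u (Real.pi / 2) = 0)
    (h : EqOn (IopW n s (s + q) u) (fun θ => c * (Real.sin θ ^ 2 * indicialKernel n s q θ))
      (Set.Ioc 0 (Real.pi / 2))) : c = 0 := by
  set β := indicialKernel n s q with hβ_def
  have hβ : LogClass s (s + 1) β := indicialKernel_logClass q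
  set V : ℝ → ℝ := fun θ => c * wronskianW n β u θ with hV
  have hV' : ∀ θ ∈ Set.Ioc 0 (Real.pi / 2), HasDerivWithinAt V
      (Real.sin θ ^ (-1 - n : ℝ) * (c * Real.sin θ * β θ) ^ 2)
      (Set.Ioc 0 (Real.pi / 2)) θ := fun θ hθ => by
    refine ((hasDerivWithinAt_wronskianW (s := s) (ν := s + q) hβ.contDiffOn hu.contDiffOn
      hθ).const_mul c).congr_deriv ?_
    rw [h hθ, IopW_indicialKernel q hθ]
    ring
  have hmono : MonotoneOn V (Set.Ioc 0 (Real.pi / 2)) := by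
    refine monotoneOn_of_hasDerivWithinAt_nonneg (convex_Ioc _ _)
      (f' := fun θ => Real.sin θ ^ (-1 - n : ℝ) * (c * Real.sin θ * β θ) ^ 2)
      (fun θ hθ => (hV' θ hθ).continuousWithinAt)
      (fun θ hθ => (hV' θ (interior_subset hθ)).mono interior_subset) fun θ hθ => ?_
    have := sin_pos_of_mem_Ioc_pi (interior_subset hθ)
    positivity
  have hV0 : Tendsto V (𝓝[>] 0) (𝓝 0) := by
    simpa using (tendsto_wronskianW hj hβ hu).const_mul c
  have hVend : V (Real.pi / 2) = 0 := by
    simp [hV, wronskianW, hd, hβ_def, (indicialKernel_pi_div_two q).1 hq]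
  have hVzero : EqOn V (fun _ => 0) (Set.Ioc 0 (Real.pi / 2)) := fun θ hθ => by
    refine le_antisymm ?_ (le_of_tendsto hV0 ?_)
    · exact (hmono hθ pi_div_two_mem_Ioc hθ.2).trans_eq hVend
    · filter_upwards [Ioc_mem_nhdsGT hθ.1] with x hx
      exact hmono ⟨hx.1, hx.2.trans hθ.2⟩ hθ hx.2
  obtain ⟨θ, hθ, hne⟩ := indicialKernel_ne_zero hj q
  have hs := sin_pos_of_mem_Ioc_pi hθ
  have h1 := dW_eq_of_hasDerivWithinAt hθ (hV' θ hθ)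
  rw [dW_congr hVzero hθ, dW_zero] at h1
  have h2 := (Real.rpow_pos_of_pos hs (-1 - n : ℝ)).ne'
  have h3 : c * Real.sin θ * β θ = 0 := by
    simpa [h2] using h1.symm
  simpa [hs.ne', hne, hβ_def] using h3

lemma exists_IopW_eq_add_of_even (hj : s = n - s + 1 + j) (hq : Even q)
    (hf : LogClass (n - s + 1) (s + 1) f) :
    ∃ u t, memA0 n s u ∧ EqOn (IopW n s (s + q) u)
      (fun θ => f θ + t * (Real.sin θ ^ 2 * indicialKernel n s q θ))
      (Set.Ioc 0 (Real.pi / 2)) := by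
  obtain ⟨v, hv, hvf⟩ := exists_IopW_eq hj q hf
  obtain ⟨w, hw, hwβ⟩ := exists_IopW_eq hj q
    ((indicialKernel_logClass' hj q).sin_sq_mul.mono 1 0 (by simp) (by simp))
  have hd : dW w (Real.pi / 2) ≠ 0 := fun hd =>
    one_ne_zero (eq_zero_of_IopW_eq_sin_sq_mul hj hq hw hd fun θ hθ => by simpa using hwβ hθ)
  refine ⟨fun θ => v θ + (-(dW v (Real.pi / 2) / dW w (Real.pi / 2))) * w θ,
    -(dW v (Real.pi / 2) / dW w (Real.pi / 2)),
    (memA0_iff hj).2 ⟨hv.add (hw.const_mul _), ?_⟩, fun θ hθ => ?_⟩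
  · rw [dW_add_const_mul _ hv.contDiffOn hw.contDiffOn pi_div_two_mem_Ioc]
    field_simp
    ring
  · rw [IopW_add_const_mul _ _ _ _ hv.contDiffOn hw.contDiffOn hθ]
    dsimp only
    rw [hvf hθ, hwβ hθ]

lemma logClass_IopW (hj : s = n - s + 1 + j) (ν : ℝ) (hu : LogClass (n - s + 1) s u) :
    LogClass (n - s + 1) (s + 1) (IopW n s ν u) := by
  have hjB : s + 1 = n - s + 1 + (j + 1 : ℕ) := by push_cast; linarith
  refine ((logClass_ladder (n - s) (j + 1) hjB (logClass_ladder_raise j hj hu)).add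
    ((hu.sin_sq_mul.mono 1 0 (by simp) (by simp)).const_mul
      (ν * (ν + 1 - n) - s * (s + 1 - n)))).congr fun θ hθ => ?_
  dsimp only
  rw [ladder_ladder n s s hu.contDiffOn hθ]
  simp only [IopW]
  ring

lemma memA0_indicialKernel (hj : s = n - s + 1 + j) (hq : Even q) :
    memA0 n s (indicialKernel n s q) :=
  (memA0_iff hj).2 ⟨indicialKernel_logClass' hj q, (indicialKernel_pi_div_two q).1 hq⟩

lemma memB_Jmap (hj : s = n - s + 1 + j) {ν : ℝ} {m : ℕ} {b : ℕ → ℝ → ℝ}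
    (hb : memE0 n s ν m b) (i : ℕ) : memB n s (Jmap n s ν b i) := by
  have hA : ∀ i, LogClass (n - s + 1) s (b i) := fun i => by
    rcases le_or_gt i m with hi | hi
    · exact ((memA0_iff hj).1 (hb.1 i hi)).1
    · rw [hb.2.1 i hi]; exact logClass_zero
  have hB : ∀ i, LogClass (n - s + 1) (s + 1) (fun θ => Real.sin θ ^ 2 * b i θ) := fun i =>
    (hA i).sin_sq_mul.mono 1 0 (by simp) (by simp)
  exact (((logClass_IopW hj ν (hA i)).add ((hB (i + 1)).const_mul ((i + 1) * (ν - i)))).add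
    ((hB (i + 2)).const_mul ((i + 2) * (i + 1)))).congr fun θ _ => by
      simp only [Jmap]; ring

end Solvability

section Tuples

open scoped ContDiff

variable {n j q m : ℕ} {s ν : ℝ} {b d f : ℕ → ℝ → ℝ}

lemma memA0.add {u v : ℝ → ℝ} (hj : s = n - s + 1 + j) (hu : memA0 n s u) (hv : memA0 n s v) :
    memA0 n s (fun θ => u θ + 1 * v θ) := by
  rw [memA0_iff hj] at *
  refine ⟨hu.1.add (hv.1.const_mul 1), ?_⟩
  rw [dW_add_const_mul _ hu.1.contDiffOn hv.1.contDiffOn pi_div_two_mem_Ioc]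
  dsimp only
  rw [hu.2, hv.2, mul_zero, add_zero]

lemma memA0_zero (hj : s = n - s + 1 + j) : memA0 n s (fun _ => 0) :=
  (memA0_iff hj).2 ⟨logClass_zero, dW_zero _⟩

lemma memA0.const_mul {u : ℝ → ℝ} (hj : s = n - s + 1 + j) (c : ℝ) (hu : memA0 n s u) :
    memA0 n s (fun θ => c * u θ) := by
  rw [memA0_iff hj] at *
  refine ⟨hu.1.const_mul c, ?_⟩
  rw [dW_const_mul _ hu.1.contDiffOn pi_div_two_mem_Ioc]
  dsimp only
  rw [hu.2, mul_zero]

lemma memE0.contDiffOn (hj : s = n - s + 1 + j) (hb : memE0 n s ν m b) (i : ℕ) :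
    ContDiffOn ℝ ∞ (b i) (Set.Ioc 0 (Real.pi / 2)) := by
  rcases le_or_gt i m with hi | hi
  · exact ((memA0_iff hj).1 (hb.1 i hi)).1.contDiffOn
  · rw [hb.2.1 i hi]; exact contDiffOn_const

lemma memE0.add (hj : s = n - s + 1 + j) (hb : memE0 n s ν m b) (hd : memE0 n s ν m d) :
    memE0 n s ν m (fun i θ => b i θ + 1 * d i θ) := by
  refine ⟨fun i hi => (hb.1 i hi).add hj (hd.1 i hi), fun i hi => ?_, fun θ hθ => ?_⟩
  · simp [hb.2.1 i hi, hd.2.1 i hi]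
  · rw [IopW_add_const_mul _ _ _ _ (hb.contDiffOn hj m) (hd.contDiffOn hj m) hθ]
    dsimp only
    rw [hb.2.2 θ hθ, hd.2.2 θ hθ, mul_zero, add_zero]

lemma Jmap_add (hj : s = n - s + 1 + j) (hb : memE0 n s ν m b) (hd : memE0 n s ν m d) (i : ℕ)
    {θ : ℝ} (hθ : θ ∈ Set.Ioc 0 (Real.pi / 2)) :
    Jmap n s ν (fun i θ => b i θ + 1 * d i θ) i θ = Jmap n s ν b i θ + Jmap n s ν d i θ := by
  simp only [Jmap]
  rw [IopW_add_const_mul _ _ _ _ (hb.contDiffOn hj i) (hd.contDiffOn hj i) hθ]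
  ring

lemma sub_natCast_pos (hj : s = n - s + 1 + j) {i : ℕ} (hi : i ≤ q) : 0 < s + q - i := by
  have h1 : (0 : ℝ) ≤ j := j.cast_nonneg
  have h2 : (0 : ℝ) ≤ n := n.cast_nonneg
  have h3 : (i : ℝ) ≤ q := by exact_mod_cast hi
  linarith

/-- Any element of `B` is attained as a single coefficient of the image of a tuple whose image has
vanishing higher coefficients. -/
lemma exists_Jmap_eq_single {i : ℕ} (hj : s = n - s + 1 + j) (hq : Even q) (him : i < m)
    (hiq : i ≤ q) {g : ℝ → ℝ} (hg : memB n s g) :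
    ∃ d, memE0 n s (s + q) m d ∧ EqOn (Jmap n s (s + q) d i) g (Set.Ioc 0 (Real.pi / 2)) ∧
      ∀ l, i < l → EqOn (Jmap n s (s + q) d l) (fun _ => 0) (Set.Ioc 0 (Real.pi / 2)) := by
  obtain ⟨u, t, hu, hut⟩ := exists_IopW_eq_add_of_even hj hq hg
  have hβ := memA0_indicialKernel hj hq
  have hβ' := (indicialKernel_logClass' hj q).contDiffOn
  have hν := (sub_natCast_pos hj hiq).ne'
  have hi : (i : ℝ) + 1 ≠ 0 := by positivity
  set τ : ℝ := -(t / ((i + 1) * (s + q - i)))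
  have hIβ : ∀ θ ∈ Set.Ioc 0 (Real.pi / 2),
      IopW n s (s + q) (fun θ => τ * indicialKernel n s q θ) θ = 0 := fun θ hθ => by
    rw [IopW_const_mul _ _ _ _ hβ' hθ]
    dsimp only
    rw [IopW_indicialKernel q hθ, mul_zero]
  set d : ℕ → ℝ → ℝ := fun l =>
    if l = i then u else if l = i + 1 then fun θ => τ * indicialKernel n s q θ else fun _ => 0
  have d0 : d i = u := by simp [d]
  have d1 : d (i + 1) = fun θ => τ * indicialKernel n s q θ := by simp [d]
  have d2 : ∀ l, i + 1 < l → d l = fun _ => 0 := fun l hl => by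
    simp only [d]
    rw [if_neg (by omega), if_neg (by omega)]
  have dI : ∀ l, i < l → ∀ θ ∈ Set.Ioc 0 (Real.pi / 2), IopW n s (s + q) (d l) θ = 0 :=
    fun l hl θ hθ => by
      rcases (Nat.succ_le_of_lt hl).eq_or_lt with rfl | hl'
      · rw [d1]; exact hIβ θ hθ
      · rw [d2 l hl', IopW_zero]
  refine ⟨d, ⟨fun l _ => ?_, fun l hl => d2 l (by omega), dI m him⟩, fun θ hθ => ?_,
    fun l hl θ hθ => ?_⟩
  · simp only [d]
    split_ifs
    exacts [hu, hβ.const_mul hj τ, memA0_zero hj]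
  · rw [Jmap, d0, d1, d2 (i + 2) (by omega), hut hθ]
    simp only [τ]
    field_simp
    ring
  · rw [Jmap, d2 (l + 1) (by omega), d2 (l + 2) (by omega), dI l hl θ hθ]
    simp

lemma exists_Jmap_eq (hj : s = n - s + 1 + j) (hq : Even q) (hm : m ≤ q + 1)
    (hf : ∀ i < m, memB n s (f i)) (k : ℕ) :
    ∃ b, memE0 n s (s + q) m b ∧ ∀ i < m, m ≤ i + k →
      EqOn (Jmap n s (s + q) b i) (f i) (Set.Ioc 0 (Real.pi / 2)) := by
  induction k with
  | zero =>
    exact ⟨fun _ _ => 0, ⟨fun _ _ => memA0_zero hj, fun _ _ => rfl, fun θ _ => IopW_zero _ _ _ θ⟩,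
      fun i hi hi' => by omega⟩
  | succ k ih =>
    obtain ⟨b, hb, hbf⟩ := ih
    rcases le_or_gt m k with hk | hk
    · exact ⟨b, hb, fun i hi _ => hbf i hi (by omega)⟩
    obtain ⟨i, rfl⟩ : ∃ i, m = i + k + 1 := ⟨m - k - 1, by omega⟩
    obtain ⟨d, hd, hdi, hdl⟩ := exists_Jmap_eq_single (i := i) hj hq
      (by omega : i < i + k + 1) (by omega) (LogClass.sub (hf i (by omega)) (memB_Jmap hj hb i))
    refine ⟨_, hb.add hj hd, fun l hl hl' θ hθ => ?_⟩
    rw [Jmap_add hj hb hd l hθ]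
    rcases (show i ≤ l by omega).eq_or_lt with rfl | hil
    · rw [hdi hθ]; ring
    · rw [hdl l hil hθ, hbf l hl (by omega) hθ, add_zero]

/-- A tuple in the kernel of `J` is a multiple of `β` at position `i`, and vanishes above. -/
lemma eq_mul_indicialKernel_of_Jmap_eq_zero (hj : s = n - s + 1 + j) (hq : Even q)
    (hm : m ≤ q + 1) (hb : memE0 n s (s + q) m b)
    (hJ : ∀ i < m, ∀ θ ∈ Set.Ioc 0 (Real.pi / 2), Jmap n s (s + q) b i θ = 0) (k : ℕ) :
    ∀ i, m = i + k → (∃ t, EqOn (b i) (fun θ => t * indicialKernel n s q θ)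
        (Set.Ioc 0 (Real.pi / 2))) ∧
      ∀ l, i < l → EqOn (b l) (fun _ => 0) (Set.Ioc 0 (Real.pi / 2)) := by
  have hA : ∀ i ≤ m, LogClass (n - s + 1) s (b i) ∧ dW (b i) (Real.pi / 2) = 0 := fun i hi =>
    (memA0_iff hj).1 (hb.1 i hi)
  induction k with
  | zero =>
    rintro i rfl
    exact ⟨exists_eq_mul_indicialKernel hj q (hA _ le_rfl).1 hb.2.2,
      fun l hl θ _ => by rw [hb.2.1 l hl]⟩
  | succ k ih =>
    intro i hi
    obtain ⟨⟨t, ht⟩, hl⟩ := ih (i + 1) (by omega)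
    have hI : EqOn (IopW n s (s + q) (b i)) (fun θ => (-((i + 1) * (s + q - i) * t)) *
        (Real.sin θ ^ 2 * indicialKernel n s q θ)) (Set.Ioc 0 (Real.pi / 2)) := fun θ hθ => by
      have h1 := hJ i (by omega) θ hθ
      rw [Jmap, ht hθ, hl (i + 2) (by omega) hθ] at h1
      dsimp only
      linear_combination h1
    have hc := eq_zero_of_IopW_eq_sin_sq_mul hj hq (hA i (by omega)).1 (hA i (by omega)).2 hI
    have hν := (sub_natCast_pos (q := q) (i := i) hj (by omega)).ne'
    have hi1 : (i : ℝ) + 1 ≠ 0 := by positivity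
    have ht0 : t = 0 := by simpa [hν, hi1] using hc
    rw [hc] at hI
    refine ⟨exists_eq_mul_indicialKernel hj q (hA i (by omega)).1 fun θ hθ => ?_,
      fun l hil => ?_⟩
    · rw [hI hθ]; exact zero_mul _
    · rcases (Nat.succ_le_of_lt hil).eq_or_lt with rfl | hl'
      · exact fun θ hθ => by rw [ht hθ, ht0]; exact zero_mul _
      · exact hl l hl'

lemma Jmap_eq_zero_of_eq_mul_indicialKernel {t : ℝ} (hb : memE0 n s (s + q) m b)
    (h0 : ∀ θ ∈ Set.Ioc 0 (Real.pi / 2), b 0 θ = t * indicialKernel n s q θ)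
    (h1 : ∀ i, 1 ≤ i → i ≤ m → ∀ θ ∈ Set.Ioc 0 (Real.pi / 2), b i θ = 0) (i : ℕ) {θ : ℝ}
    (hθ : θ ∈ Set.Ioc 0 (Real.pi / 2)) : Jmap n s (s + q) b i θ = 0 := by
  have hz : ∀ l, EqOn (b (l + 1)) (fun _ => 0) (Set.Ioc 0 (Real.pi / 2)) := fun l x hx => by
    rcases le_or_gt (l + 1) m with hl | hl
    · exact h1 _ (by omega) hl x hx
    · rw [hb.2.1 _ hl]
  have hI : IopW n s (s + q) (b i) θ = 0 := by
    cases i with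
    | zero =>
      rw [IopW_congr n s _ h0 hθ,
        IopW_const_mul _ _ _ _ (indicialKernel_logClass (n := n) (s := s) q).contDiffOn hθ]
      dsimp only
      rw [IopW_indicialKernel q hθ, mul_zero]
    | succ i => rw [IopW_congr n s _ (hz i) hθ, IopW_zero]
  rw [Jmap, hI, hz i hθ, hz (i + 1) hθ]
  simp

end Tuples

/-- for `2s ∈ ℤ`, even `q ≥ 0`, `ν = s + q`, `m = q/2 + 1`, the map
`J : E⁰ → B^m` is well defined and surjective, with kernel the line spanned by
`(β, 0, …, 0)` where `β` is a nonzero kernel element of `I_{s,ν}` in `A⁰`. -/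
theorem stmt_17 (n : ℕ) (hn : 2 ≤ n) (s : ℝ) (hs : (n : ℝ) / 2 < s)
    (h2s : ∃ z : ℤ, 2 * s = (z : ℝ))
    (q : ℕ) (hqeven : Even q)
    (m : ℕ) (hm : m = q / 2 + 1) :
    (∀ b : ℕ → ℝ → ℝ, memE0 n s (s + (q : ℝ)) m b →
      ∀ i < m, memB n s (Jmap n s (s + (q : ℝ)) b i)) ∧
    (∀ f : ℕ → ℝ → ℝ, (∀ i < m, memB n s (f i)) →
      ∃ b : ℕ → ℝ → ℝ, memE0 n s (s + (q : ℝ)) m b ∧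
        ∀ i < m, ∀ θ ∈ Set.Ioc 0 (Real.pi / 2),
          Jmap n s (s + (q : ℝ)) b i θ = f i θ) ∧
    (∃ β : ℝ → ℝ, memA0 n s β ∧ (∃ θ ∈ Set.Ioc 0 (Real.pi / 2), β θ ≠ 0) ∧
      (∀ θ ∈ Set.Ioc 0 (Real.pi / 2), IopW n s (s + (q : ℝ)) β θ = 0) ∧
      ∀ b : ℕ → ℝ → ℝ, memE0 n s (s + (q : ℝ)) m b →
        ((∀ i < m, ∀ θ ∈ Set.Ioc 0 (Real.pi / 2),
            Jmap n s (s + (q : ℝ)) b i θ = 0) ↔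
          ∃ t : ℝ, (∀ θ ∈ Set.Ioc 0 (Real.pi / 2), b 0 θ = t * β θ) ∧
            ∀ i, 1 ≤ i → i ≤ m →
              ∀ θ ∈ Set.Ioc 0 (Real.pi / 2), b i θ = 0)) := by
  obtain ⟨j, hj⟩ : ∃ j : ℕ, s = n - s + 1 + j := by
    obtain ⟨z, hz⟩ := h2s
    have h1 : (n : ℤ) < z := by
      have : (n : ℝ) < z := by linarith
      exact_mod_cast this
    obtain ⟨j, hj⟩ := Int.le.dest (Int.add_one_le_of_lt h1)
    refine ⟨j, ?_⟩
    have h2 : (n : ℝ) + 1 + j = z := by exact_mod_cast hj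
    linarith
  have hmq : m ≤ q + 1 := by omega
  refine ⟨fun b hb i _ => memB_Jmap hj hb i, fun f hf => ?_, indicialKernel n s q,
    memA0_indicialKernel hj hqeven, indicialKernel_ne_zero hj q, IopW_indicialKernel q,
    fun b hb => ⟨fun hJ => ?_, fun ⟨t, h0, h1⟩ i _ θ hθ =>
      Jmap_eq_zero_of_eq_mul_indicialKernel hb h0 h1 i hθ⟩⟩
  · obtain ⟨b, hb, hbf⟩ := exists_Jmap_eq hj hqeven hmq hf m
    exact ⟨b, hb, fun i hi θ hθ => hbf i hi (by omega) hθ⟩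
  · obtain ⟨⟨t, ht⟩, hl⟩ :=
      eq_mul_indicialKernel_of_Jmap_eq_zero hj hqeven hmq hb hJ m 0 (by omega)
    exact ⟨t, ht, fun i hi _ => hl i hi⟩
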